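/- arXiv:2211.10454 — 4 statements merged into one kernel-verified Lean document; each statement's English description precedes it below -/
import Mathlib

section
/- Let t, u ∈ ℂ with ‖t‖ < 1 and ‖u‖ < 1. Then the iterated normalized contour integral over |z| = 1 and |w| = 1 of PE_F[(z+1/z)(w+1/w); u] · PE_B[z+1/z; t] · PE_B[w+1/w; t] against the measure dμ_{SU(2)}(z) dμ_{SU(2)}(w) equals 1 − t²(1−u)²u + u⁴. (Here (z+1/z)(w+1/w) is expanded into its four monomials zw, z/w, w/z, 1/(zw).) This is the Hilbert–Poincaré series of SO(4)-invariant form polynomials in the supervielbein of D=4, N=1 flat superspace. -/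
/-- Normalized contour integral `(2πi)⁻¹ ∮_{|z|=1} f(z) dz` over the positively
oriented unit circle. -/
noncomputable def cint (f : ℂ → ℂ) : ℂ :=
  (2 * (Real.pi : ℂ) * Complex.I)⁻¹ * (∮ z in C(0, 1), f z)

/-- Normalized contour integral `∮ f(z) dz/(2πi z)`. -/
noncomputable def nint (f : ℂ → ℂ) : ℂ :=
  cint fun z => f z / z

/-- Bosonic plethystic exponential `PE_B[χ; t] = ∏_j (1 - t mⱼ)⁻¹`, for `χ` the
sum of the Laurent monomials `mⱼ` in the list `ms`. -/
noncomputable def PE_B (t : ℂ) (ms : List ℂ) : ℂ :=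
  ((ms.map fun m => 1 - t * m).prod)⁻¹

/-- Fermionic plethystic exponential `PE_F[χ; t] = ∏_j (1 - t mⱼ)`. -/
noncomputable def PE_F (t : ℂ) (ms : List ℂ) : ℂ :=
  (ms.map fun m => 1 - t * m).prod

/-- Negative powers of `w` times a simple pole in the open unit disc have no residue in total. -/
theorem circleIntegral_inv_pow_mul_sub_inv {t : ℂ} (ht : ‖t‖ < 1) (n : ℕ) :
    (∮ w in C(0, 1), (w ^ (n + 1))⁻¹ * (w - t)⁻¹) = 0 := by
  have hpow (m : ℕ) : (∮ w in C((0 : ℂ), 1), (w ^ (m + 2))⁻¹) = 0 := by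
    have h := circleIntegral.integral_sub_zpow_of_ne (n := -((m : ℤ) + 2)) (by omega) 0 0 1
    simp only [sub_zero, zpow_neg] at h
    exact_mod_cast h
  rcases eq_or_ne t 0 with rfl | h0
  · simp only [sub_zero, ← mul_inv, ← pow_succ]
    exact hpow n
  have hw0 {w : ℂ} (hw : w ∈ Metric.sphere (0 : ℂ) 1) : w ≠ 0 :=
    ne_zero_of_mem_unit_sphere (⟨w, hw⟩ : Metric.sphere (0 : ℂ) 1)
  have hwt {w : ℂ} (hw : w ∈ Metric.sphere (0 : ℂ) 1) : w - t ≠ 0 := by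
    rw [sub_ne_zero]
    rintro rfl
    exact ht.ne (by simpa using hw)
  have hint (m : ℕ) : CircleIntegrable (fun w : ℂ => (w ^ m)⁻¹) 0 1 :=
    ContinuousOn.circleIntegrable zero_le_one
      ((by fun_prop : ContinuousOn (fun w : ℂ => w ^ m) _).inv₀
        fun w hw => pow_ne_zero _ (hw0 hw))
  have hint' (m : ℕ) : CircleIntegrable (fun w : ℂ => (w ^ m)⁻¹ * (w - t)⁻¹) 0 1 := by
    refine ContinuousOn.circleIntegrable zero_le_one (.mul ?_ ?_)
    · exact (by fun_prop : ContinuousOn (fun w : ℂ => w ^ m) _).inv₀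
        fun w hw => pow_ne_zero _ (hw0 hw)
    · exact (by fun_prop : ContinuousOn (fun w : ℂ => w - t) _).inv₀ fun w hw => hwt hw
  have hrec (m : ℕ) : (∮ w in C(0, 1), (w ^ (m + 1))⁻¹ * (w - t)⁻¹) =
      t⁻¹ * ((∮ w in C(0, 1), (w ^ m)⁻¹ * (w - t)⁻¹) - ∮ w in C(0, 1), (w ^ (m + 1))⁻¹) := by
    rw [← circleIntegral.integral_sub (hint' m) (hint (m + 1)),
      ← circleIntegral.integral_const_mul]
    refine circleIntegral.integral_congr zero_le_one fun w hw => ?_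
    have := hw0 hw
    have := hwt hw
    field_simp
    ring
  induction n with
  | zero =>
    have h1 := circleIntegral.integral_sub_inv_of_mem_ball (c := 0) (R := 1) (w := t) (by simpa)
    have h2 := circleIntegral.integral_sub_center_inv (0 : ℂ) one_ne_zero
    rw [hrec]
    simp only [sub_zero] at h2
    simp [h1, h2]
  | succ n ih => rw [hrec, ih, hpow, sub_zero, mul_zero]

/-- The `SU(2)` average of a Laurent polynomial of degree at most two against the bosonic
plethystic exponential of the fundamental representation. -/
theorem nint_weyl_laurent_mul_PE_B {t : ℂ} (ht : ‖t‖ < 1) (a b c d e : ℂ) :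
    (nint fun w => (1 - w ^ 2) *
      ((a * (w ^ 2)⁻¹ + b * w⁻¹ + c + d * w + e * w ^ 2) * PE_B t [w, 1 / w])) =
      -a + c + d * t + e * t ^ 2 := by
  have hw0 {w : ℂ} (hw : w ∈ Metric.sphere (0 : ℂ) 1) : w ≠ 0 :=
    ne_zero_of_mem_unit_sphere (⟨w, hw⟩ : Metric.sphere (0 : ℂ) 1)
  have hwt {w : ℂ} (hw : w ∈ Metric.sphere (0 : ℂ) 1) : w - t ≠ 0 := by
    rw [sub_ne_zero]
    rintro rfl
    exact ht.ne (by simpa using hw)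
  have htw {w : ℂ} (hw : w ∈ Metric.closedBall (0 : ℂ) 1) : 1 - t * w ≠ 0 := by
    rw [sub_ne_zero]
    intro h
    have hn : ‖t‖ * ‖w‖ = 1 := by rw [← norm_mul, ← h, norm_one]
    have hw1 : ‖w‖ ≤ 1 := by simpa using hw
    nlinarith [norm_nonneg t]
  have hinv (m : ℕ) : ContinuousOn (fun w : ℂ => (w ^ m)⁻¹) (Metric.sphere 0 1) :=
    (by fun_prop : ContinuousOn (fun w : ℂ => w ^ m) _).inv₀ fun w hw => pow_ne_zero _ (hw0 hw)
  have hsub : ContinuousOn (fun w : ℂ => (w - t)⁻¹) (Metric.sphere 0 1) :=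
    (by fun_prop : ContinuousOn (fun w : ℂ => w - t) _).inv₀ fun w hw => hwt hw
  have hdiff : DifferentiableOn ℂ
      (fun w : ℂ => (a + b * w + c * w ^ 2 + d * w ^ 3 + e * w ^ 4) * (1 - t * w)⁻¹)
      (Metric.closedBall 0 1) :=
    (by fun_prop : DifferentiableOn ℂ
      (fun w : ℂ => a + b * w + c * w ^ 2 + d * w ^ 3 + e * w ^ 4) _).mul
      ((by fun_prop : DifferentiableOn ℂ (fun w : ℂ => 1 - t * w) _).inv fun w hw => htw hw)
  have hpole := DifferentiableOn.circleIntegral_sub_inv_smul (c := 0) (R := 1) (w := t)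
    (f := fun w : ℂ => c + d * w + e * w ^ 2) (by fun_prop) (by simpa)
  have hzero := hdiff.circleIntegral_sub_inv_smul (w := 0) (by simp)
  have hcont₁ : ContinuousOn (fun w : ℂ => a * ((w ^ (1 + 1))⁻¹ * (w - t)⁻¹))
      (Metric.sphere 0 1) := continuousOn_const.mul ((hinv _).mul hsub)
  have hcont₂ : ContinuousOn (fun w : ℂ => b * ((w ^ (0 + 1))⁻¹ * (w - t)⁻¹))
      (Metric.sphere 0 1) := continuousOn_const.mul ((hinv _).mul hsub)
  have hcont₃ : ContinuousOn (fun w : ℂ => (w - t)⁻¹ • (c + d * w + e * w ^ 2))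
      (Metric.sphere 0 1) := hsub.smul (by fun_prop)
  have hcont₄ : ContinuousOn (fun w : ℂ => (w - 0)⁻¹ •
      ((a + b * w + c * w ^ 2 + d * w ^ 3 + e * w ^ 4) * (1 - t * w)⁻¹))
      (Metric.sphere 0 1) := by
    have h : ContinuousOn (fun w : ℂ => (w - 0)⁻¹) (Metric.sphere 0 1) := by simpa using hinv 1
    exact h.smul (hdiff.continuousOn.mono Metric.sphere_subset_closedBall)
  have key : (∮ w in C(0, 1), (1 - w ^ 2) *
      ((a * (w ^ 2)⁻¹ + b * w⁻¹ + c + d * w + e * w ^ 2) * PE_B t [w, 1 / w]) / w) =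
      ∮ w in C(0, 1), (a * ((w ^ (1 + 1))⁻¹ * (w - t)⁻¹) + b * ((w ^ (0 + 1))⁻¹ * (w - t)⁻¹) +
        (w - t)⁻¹ • (c + d * w + e * w ^ 2)) - (w - 0)⁻¹ •
          ((a + b * w + c * w ^ 2 + d * w ^ 3 + e * w ^ 4) * (1 - t * w)⁻¹) := by
    refine circleIntegral.integral_congr zero_le_one fun w hw => ?_
    have h0 := hw0 hw
    have h1 := hwt hw
    have h2 := htw (Metric.sphere_subset_closedBall hw)
    have hPE : PE_B t [w, 1 / w] = w * ((1 - t * w)⁻¹ * (w - t)⁻¹) := by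
      have h3 : 1 - t * (1 / w) = (w - t) / w := by field_simp
      simp only [PE_B, List.map_cons, List.map_nil, List.prod_cons, List.prod_nil, h3]
      field_simp
    rw [mul_comm t w] at h2
    simp only [hPE, mul_comm t w, smul_eq_mul, sub_zero]
    field_simp
    ring
  rw [nint, cint, key,
    circleIntegral.integral_sub
      (((hcont₁.fun_add hcont₂).fun_add hcont₃).circleIntegrable zero_le_one)
      (hcont₄.circleIntegrable zero_le_one),
    circleIntegral.integral_add
      ((hcont₁.fun_add hcont₂).circleIntegrable zero_le_one) (hcont₃.circleIntegrable zero_le_one),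
    circleIntegral.integral_add
      (hcont₁.circleIntegrable zero_le_one) (hcont₂.circleIntegrable zero_le_one),
    circleIntegral.integral_const_mul, circleIntegral.integral_const_mul,
    circleIntegral_inv_pow_mul_sub_inv ht, circleIntegral_inv_pow_mul_sub_inv ht, hpole, hzero]
  have := Complex.two_pi_I_ne_zero
  simp only [smul_eq_mul]
  rw [inv_mul_eq_iff_eq_mul₀ this]
  ring

/-- `nint` does not see the value of the integrand at the origin. -/
theorem nint_congr {f g : ℂ → ℂ} (h : ∀ z : ℂ, z ≠ 0 → f z = g z) : nint f = nint g := by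
  rw [nint, nint, cint, cint]
  congr 1
  refine circleIntegral.integral_congr zero_le_one fun z hz => ?_
  simp only [h z (ne_zero_of_mem_unit_sphere (⟨z, hz⟩ : Metric.sphere (0 : ℂ) 1))]

/-- The Hilbert–Poincaré series of `SO(4)`-invariant form polynomials in the
supervielbein of `D=4`, `N=1` flat superspace:
`∮∮ PE_F[(z+1/z)(w+1/w); u] PE_B[z+1/z; t] PE_B[w+1/w; t] dμ_SU(2)(z) dμ_SU(2)(w)
 = 1 - t²(1-u)²u + u⁴`. -/
theorem statement_0 (t u : ℂ) (ht : ‖t‖ < 1) (hu : ‖u‖ < 1) :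
    (nint fun z => (1 - z ^ 2) *
      nint fun w => (1 - w ^ 2) *
        (PE_F u [z * w, z / w, w / z, 1 / (z * w)] *
         PE_B t [z, 1 / z] * PE_B t [w, 1 / w]))
      = 1 - t ^ 2 * (1 - u) ^ 2 * u + u ^ 4 := by
  have hinner (z : ℂ) (hz : z ≠ 0) : (nint fun w => (1 - w ^ 2) *
        (PE_F u [z * w, z / w, w / z, 1 / (z * w)] *
         PE_B t [z, 1 / z] * PE_B t [w, 1 / w])) =
      (u ^ 2 * (z ^ 2)⁻¹ + -(t * u * (1 + u ^ 2)) * z⁻¹ +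
        (1 + u ^ 2 + u ^ 4 + t ^ 2 * u ^ 2) + -(t * u * (1 + u ^ 2)) * z + u ^ 2 * z ^ 2) *
        PE_B t [z, 1 / z] := by
    set B := PE_B t [z, 1 / z]
    have h := nint_weyl_laurent_mul_PE_B ht (u ^ 2 * B) (-(u * (1 + u ^ 2) * (z + z⁻¹)) * B)
      ((1 + u ^ 2 * (z + z⁻¹) ^ 2 + u ^ 4) * B) (-(u * (1 + u ^ 2) * (z + z⁻¹)) * B) (u ^ 2 * B)
    refine (nint_congr fun w hw => ?_).trans (h.trans ?_)
    · congr 2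
      simp only [PE_F, List.map_cons, List.map_nil, List.prod_cons, List.prod_nil]
      field_simp
      ring
    · field_simp
      ring
  rw [nint_congr fun z hz => congrArg ((1 - z ^ 2) * ·) (hinner z hz),
    nint_weyl_laurent_mul_PE_B ht]
  ring
end

section
/- Let t, u ∈ ℂ with ‖t‖ < 1 and ‖u‖ < 1. Then the iterated normalized contour integral over |z| = 1 and |w| = 1 (each against dμ_{SU(2)}) and over |z₁| = |z₂| = |z₃| = 1 (against dμ_{SU(4)}) of PE_F[(z+1/z)(w+1/w); u] · PE_B[(z₁ + z₂/z₁ + z₃/z₂ + 1/z₃)(z+1/z); t] · PE_B[(z₃ + z₂/z₃ + z₁/z₂ + 1/z₁)(w+1/w); t] equals (1 − t²(u + u³) + u⁴)/(1 − t⁴). This is the Hilbert–Poincaré series of (SO(4)×SU(4))-invariant form polynomials for D=4, N=4 flat superspace. -/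
/-- Weight of the `SU(4)` Weyl measure, so that
`dμ_SU(4) = muSU4 z₁ z₂ z₃ · dz₁ dz₂ dz₃ / ((2πi)³ z₁ z₂ z₃)`. -/
noncomputable def muSU4 (z₁ z₂ z₃ : ℂ) : ℂ :=
  (1 - z₁ ^ 2 / z₂) * (1 - z₁ * z₂ / z₃) * (1 - z₁ * z₃) *
  (1 - z₂ ^ 2 / (z₁ * z₃)) * (1 - z₂ * z₃ / z₁) * (1 - z₃ ^ 2 / z₂)

open MeasureTheory AddCircle

instance factTwoPiPos : Fact (0 < 2 * Real.pi) := ⟨Real.two_pi_pos⟩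

/-- The additive circle, parametrizing the unit circle by its angle. -/
abbrev Phase : Type := AddCircle (2 * Real.pi)

/-- The point of the complex unit circle with the given angle. -/
noncomputable def cis (x : Phase) : ℂ := toCircle x

noncomputable instance coePhase : CoeOut Phase ℂ := ⟨cis⟩

@[simp] theorem norm_cis (x : Phase) : ‖(x : ℂ)‖ = 1 := Circle.norm_coe _

@[simp] theorem cis_ne_zero (x : Phase) : (x : ℂ) ≠ 0 := Circle.coe_ne_zero _

@[simp] theorem cis_zero : ((0 : Phase) : ℂ) = 1 := by simp [cis]

@[simp] theorem cis_add (x y : Phase) : ((x + y : Phase) : ℂ) = x * y := by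
  rw [cis, toCircle_add, Circle.coe_mul, cis, cis]

@[simp] theorem cis_neg (x : Phase) : ((-x : Phase) : ℂ) = (x : ℂ)⁻¹ := by
  rw [cis, toCircle_neg, Circle.coe_inv, cis]

@[simp] theorem cis_sub (x y : Phase) : ((x - y : Phase) : ℂ) = x / y := by
  rw [sub_eq_add_neg, cis_add, cis_neg, div_eq_mul_inv]

@[fun_prop] theorem continuous_cis : Continuous cis :=
  (by fun_prop : Continuous fun x : Circle => (x : ℂ)).comp continuous_toCircle

theorem cis_coe (θ : ℝ) : cis (θ : Phase) = circleMap 0 1 θ := by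
  rw [cis, toCircle_apply_mk, div_self Real.two_pi_pos.ne', one_mul, Circle.coe_exp]
  simp [circleMap]

/-- Average of a function over the circle with respect to normalized Haar measure. -/
noncomputable def avg (f : Phase → ℂ) : ℂ := ∫ a, f a ∂haarAddCircle

theorem nint_eq_avg (f : ℂ → ℂ) : nint f = avg fun x => f x := by
  rw [avg, integral_haarAddCircle, ← AddCircle.intervalIntegral_preimage _ 0, zero_add]
  simp only [cis_coe, nint, cint, circleIntegral, deriv_circleMap, smul_eq_mul]
  have h : ∀ θ : ℝ, circleMap 0 1 θ * Complex.I * (f (circleMap 0 1 θ) / circleMap 0 1 θ)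
      = Complex.I * f (circleMap 0 1 θ) := fun θ => by
    have : circleMap 0 1 θ ≠ 0 := circleMap_ne_center one_ne_zero
    field_simp
  simp only [h, intervalIntegral.integral_const_mul, Complex.real_smul]
  push_cast
  have := Complex.I_ne_zero
  have : (Real.pi : ℂ) ≠ 0 := by exact_mod_cast Real.pi_ne_zero
  field_simp

theorem avg_const_mul (c : ℂ) (f : Phase → ℂ) : avg (fun x => c * f x) = c * avg f :=
  integral_const_mul _ _

theorem avg_add {f g : Phase → ℂ} (hf : Continuous f) (hg : Continuous g) :
    avg (fun x => f x + g x) = avg f + avg g :=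
  integral_add (hf.integrable_of_hasCompactSupport (HasCompactSupport.of_compactSpace _))
    (hg.integrable_of_hasCompactSupport (HasCompactSupport.of_compactSpace _))

theorem avg_linear_combination (c d : ℂ) {f g : Phase → ℂ} (hf : Continuous f)
    (hg : Continuous g) : avg (fun x => c * f x + d * g x) = c * avg f + d * avg g := by
  rw [avg_add (f := fun x => c * f x) (g := fun x => d * g x) (by fun_prop) (by fun_prop),
    avg_const_mul, avg_const_mul]

theorem avg_sub_right (f : Phase → ℂ) (c : Phase) : avg (fun x => f (x - c)) = avg f :=
  integral_sub_right_eq_self (μ := haarAddCircle) f c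

theorem avg_neg (f : Phase → ℂ) : avg (fun x => f (-x)) = avg f :=
  integral_neg_eq_self (μ := haarAddCircle) f

theorem avg_swap {f : Phase → Phase → ℂ} (hf : Continuous fun p : Phase × Phase => f p.1 p.2) :
    (avg fun x => avg fun y => f x y) = avg fun y => avg fun x => f x y :=
  integral_integral_swap (hf.integrable_of_hasCompactSupport (HasCompactSupport.of_compactSpace _))

theorem continuous_avg {X : Type*} [TopologicalSpace X] [FirstCountableTopology X]
    [LocallyCompactSpace X] {f : X → Phase → ℂ}
    (hf : Continuous fun p : X × Phase => f p.1 p.2) : Continuous fun x => avg (f x) := by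
  have := continuous_parametric_integral_of_continuous (μ := haarAddCircle) hf isCompact_univ
  simpa only [setIntegral_univ, avg] using this

/-- Cauchy's integral formula, as an average over the unit circle. -/
theorem avg_one_pole {g : ℂ → ℂ} (hg : DifferentiableOn ℂ g (Metric.closedBall 0 1)) {a : ℂ}
    (ha : ‖a‖ < 1) : (avg fun x => g x / (1 - a / x)) = g a := by
  rw [← nint_eq_avg fun x => g x / (1 - a / x), nint, cint]
  have h := Complex.circleIntegral_sub_inv_smul_of_differentiable_on_off_countable
    (c := 0) (R := 1) (f := g) Set.countable_empty (by simpa using ha) hg.continuousOn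
    fun x hx => (hg x (Metric.ball_subset_closedBall hx.1)).differentiableAt
      (Metric.closedBall_mem_nhds_of_mem hx.1)
  rw [← inv_mul_cancel_left₀ Complex.two_pi_I_ne_zero (g a), ← smul_eq_mul (a := _ * _) (b := g a),
    ← h]
  congr 1
  refine circleIntegral.integral_congr zero_le_one fun x hx => ?_
  have hx1 : ‖x‖ = 1 := by simpa using hx
  have hx0 : x ≠ 0 := by rintro rfl; simp at hx1
  have hxa : x - a ≠ 0 := fun h0 => by rw [sub_eq_zero] at h0; subst h0; linarith
  simp only [smul_eq_mul]
  rw [one_sub_div hx0]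
  field_simp

theorem avg_of_differentiableOn {g : ℂ → ℂ} (hg : DifferentiableOn ℂ g (Metric.closedBall 0 1)) :
    (avg fun x => g x) = g 0 := by
  simpa using avg_one_pole hg (a := 0) (by simp)

/-- A continuous function on the circle all of whose nonconstant Fourier coefficients vanish
is equal to its average. -/
theorem eq_avg_of_zpow_avg_eq_zero {f : Phase → ℂ} (hf : Continuous f)
    (h : ∀ n : ℤ, n ≠ 0 → (avg fun x => (x : ℂ) ^ n * f x) = 0) : f 0 = avg f := by
  let F : C(Phase, ℂ) := ⟨f, hf⟩
  have hc : ∀ n : ℤ, fourierCoeff F n = avg fun x => (x : ℂ) ^ (-n) * f x := fun n => by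
    simp only [fourierCoeff, avg, F, fourier_apply, toCircle_zsmul, Circle.coe_zpow, smul_eq_mul,
      cis, ContinuousMap.coe_mk]
  have h0 : ∀ n : ℤ, n ≠ 0 → fourierCoeff F n = 0 := fun n hn => by
    rw [hc, h _ (neg_ne_zero.2 hn)]
  have hs := has_pointwise_sum_fourier_series_of_summable
    (summable_of_ne_finset_zero (s := {0}) fun n hn => h0 n (by simpa using hn)) 0
  have := hs.unique (hasSum_single 0 fun n hn => by rw [h0 n hn, zero_smul])
  rw [hc] at this
  simpa [F] using this

theorem one_sub_ne_zero_of_norm_lt {a : ℂ} (ha : ‖a‖ < 1) : 1 - a ≠ 0 := by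
  rintro h
  rw [← sub_eq_zero.1 h] at ha
  simp at ha

theorem one_sub_mul_cis_ne_zero {a : ℂ} (ha : ‖a‖ < 1) (x : Phase) : 1 - a * x ≠ 0 :=
  one_sub_ne_zero_of_norm_lt (by simpa using ha)

theorem one_sub_div_cis_ne_zero {a : ℂ} (ha : ‖a‖ < 1) (x : Phase) : 1 - a / x ≠ 0 :=
  one_sub_ne_zero_of_norm_lt (by simpa using ha)

theorem one_sub_mul_ne_zero_of_mem_closedBall {a x : ℂ} (ha : ‖a‖ < 1)
    (hx : x ∈ Metric.closedBall (0 : ℂ) 1) : 1 - a * x ≠ 0 := by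
  refine one_sub_ne_zero_of_norm_lt ?_
  rw [norm_mul]
  exact (mul_le_of_le_one_right (norm_nonneg a) (by simpa using hx)).trans_lt ha

theorem avg_two_poles {g : ℂ → ℂ} (hg : DifferentiableOn ℂ g (Metric.closedBall 0 1)) {q : ℂ}
    (hq : ‖q‖ < 1) {β₁ β₂ : Phase} (hβ : (β₁ : ℂ) ≠ β₂) :
    (avg fun x => g x / ((1 - q * β₁ / x) * (1 - q * β₂ / x)))
      = (β₁ * g (q * β₁) - β₂ * g (q * β₂)) / (β₁ - β₂) := by
  have hgc : Continuous fun x : Phase => g x :=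
    hg.continuousOn.comp_continuous continuous_cis fun x => by simp
  have hn : ∀ β : Phase, ‖q * β‖ < 1 := fun β => by simpa using hq
  have hne : ∀ β x : Phase, 1 - q * β / (x : ℂ) ≠ 0 := fun β =>
    one_sub_div_cis_ne_zero (hn β)
  have hx0 : ∀ x : Phase, (x : ℂ) ≠ 0 := cis_ne_zero
  have hd := sub_ne_zero.2 hβ
  have hc : ∀ β : Phase, Continuous fun x : Phase => g x / (1 - q * β / x) := fun β =>
    hgc.div (by fun_prop (disch := exact hx0)) (hne β)
  have key : ∀ x : Phase, g x / ((1 - q * β₁ / x) * (1 - q * β₂ / x))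
      = β₁ / (β₁ - β₂ : ℂ) * (g x / (1 - q * β₁ / x))
        + -β₂ / (β₁ - β₂ : ℂ) * (g x / (1 - q * β₂ / x)) := fun x => by
    have h1 := hne β₁ x
    have h2 := hne β₂ x
    have h3 := hx0 x
    rw [div_mul_div_comm, div_mul_div_comm, div_add_div _ _ (mul_ne_zero hd h1)
      (mul_ne_zero hd h2), div_eq_div_iff (mul_ne_zero h1 h2)
      (mul_ne_zero (mul_ne_zero hd h1) (mul_ne_zero hd h2))]
    field_simp
    ring
  simp only [key]
  rw [avg_linear_combination _ _ (hc _) (hc _), avg_one_pole hg (hn _), avg_one_pole hg (hn _)]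
  ring

/-- Numerator of the Weyl measure of `U(4)` in the eigenvalue variables. -/
noncomputable def weylU4 (a b c d : ℂ) : ℂ :=
  (1 - a / b) * (1 - a / c) * (1 - a / d) * (1 - b / c) * (1 - b / d) * (1 - c / d)

/-- Contribution of the eigenvalue `x` to the `U(4)` integrand for two fundamental and two
antifundamental flavours, twisted by the `k`-th power of the determinant. -/
noncomputable def flavorWeight (k : ℤ) (p₁ p₂ q₁ q₂ x : ℂ) : ℂ :=
  x ^ k / ((1 - p₁ * x) * (1 - p₂ * x) * ((1 - q₁ / x) * (1 - q₂ / x)))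

theorem flavorWeight_inv (k : ℤ) (p₁ p₂ q₁ q₂ x : ℂ) :
    flavorWeight k p₁ p₂ q₁ q₂ x⁻¹ = flavorWeight (-k) q₁ q₂ p₁ p₂ x := by
  simp only [flavorWeight, inv_zpow', div_inv_eq_mul, ← div_eq_mul_inv]
  rw [mul_comm ((1 - p₁ / x) * (1 - p₂ / x))]

theorem continuous_flavorWeight (k : ℤ) {p₁ p₂ q₁ q₂ : ℂ} (hp₁ : ‖p₁‖ < 1) (hp₂ : ‖p₂‖ < 1)
    (hq₁ : ‖q₁‖ < 1) (hq₂ : ‖q₂‖ < 1) :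
    Continuous fun x : Phase => flavorWeight k p₁ p₂ q₁ q₂ x := by
  unfold flavorWeight
  have hx0 : ∀ x : Phase, (x : ℂ) ≠ 0 := cis_ne_zero
  refine Continuous.div (continuous_cis.zpow₀ k fun x => Or.inl (hx0 x)) ?_ fun x => ?_
  · fun_prop (disch := exact hx0)
  · exact mul_ne_zero (mul_ne_zero (one_sub_mul_cis_ne_zero hp₁ x)
      (one_sub_mul_cis_ne_zero hp₂ x)) (mul_ne_zero (one_sub_div_cis_ne_zero hq₁ x)
      (one_sub_div_cis_ne_zero hq₂ x))

theorem differentiableOn_div_one_sub_mul {p₁ p₂ : ℂ} (hp₁ : ‖p₁‖ < 1) (hp₂ : ‖p₂‖ < 1)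
    {f : ℂ → ℂ} (hf : Differentiable ℂ f) :
    DifferentiableOn ℂ (fun x => f x / ((1 - p₁ * x) * (1 - p₂ * x)))
      (Metric.closedBall 0 1) := by
  refine hf.differentiableOn.div (by fun_prop) fun x hx => mul_ne_zero ?_ ?_
  · exact one_sub_mul_ne_zero_of_mem_closedBall hp₁ hx
  · exact one_sub_mul_ne_zero_of_mem_closedBall hp₂ hx

/-- The integral over the first two eigenvalues. -/
theorem avg_avg_weylU4 {p₁ p₂ q : ℂ} (hp₁ : ‖p₁‖ < 1) (hp₂ : ‖p₂‖ < 1) (hq : ‖q‖ < 1)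
    {β₁ β₂ : Phase} (hβ : (β₁ : ℂ) ≠ β₂) (k : ℕ) (c d : Phase) :
    (avg fun b => avg fun a => weylU4 a b c d *
      (flavorWeight k p₁ p₂ (q * β₁) (q * β₂) a * flavorWeight k p₁ p₂ (q * β₁) (q * β₂) b *
        flavorWeight k p₁ p₂ (q * β₁) (q * β₂) c * flavorWeight k p₁ p₂ (q * β₁) (q * β₂) d))
    = (q * β₁) ^ k / ((1 - p₁ * (q * β₁)) * (1 - p₂ * (q * β₁))) *
      ((q * β₂) ^ k / ((1 - p₁ * (q * β₂)) * (1 - p₂ * (q * β₂)))) *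
      ((d : ℂ) ^ k / ((1 - p₁ * d) * (1 - p₂ * d)) *
        ((c : ℂ) ^ k * (1 - c / d) / ((1 - p₁ * c) * (1 - p₂ * c)))) := by
  have hx0 : ∀ x : Phase, (x : ℂ) ≠ 0 := cis_ne_zero
  have hn : ∀ β : Phase, ‖q * β‖ < 1 := fun β => by simpa using hq
  have hne : ∀ β x : Phase, 1 - q * β / (x : ℂ) ≠ 0 := fun β =>
    one_sub_div_cis_ne_zero (hn β)
  have hd := sub_ne_zero.2 hβ
  have inner : ∀ b : Phase, (avg fun a => weylU4 a b c d *
      (flavorWeight k p₁ p₂ (q * β₁) (q * β₂) a * flavorWeight k p₁ p₂ (q * β₁) (q * β₂) b *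
        flavorWeight k p₁ p₂ (q * β₁) (q * β₂) c * flavorWeight k p₁ p₂ (q * β₁) (q * β₂) d))
      = (1 - c / d) * (flavorWeight k p₁ p₂ (q * β₁) (q * β₂) c *
          flavorWeight k p₁ p₂ (q * β₁) (q * β₂) d) / (β₁ - β₂) *
          (β₁ * ((q * β₁) ^ k / ((1 - p₁ * (q * β₁)) * (1 - p₂ * (q * β₁)))) *
            ((1 - q * β₁ / c) * (1 - q * β₁ / d))) *
          ((b ^ k * ((1 - b / c) * (1 - b / d)) / ((1 - p₁ * b) * (1 - p₂ * b))) /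
            (1 - q * β₂ / b))
        + (1 - c / d) * (flavorWeight k p₁ p₂ (q * β₁) (q * β₂) c *
          flavorWeight k p₁ p₂ (q * β₁) (q * β₂) d) / (β₁ - β₂) *
          (-β₂ * ((q * β₂) ^ k / ((1 - p₁ * (q * β₂)) * (1 - p₂ * (q * β₂)))) *
            ((1 - q * β₂ / c) * (1 - q * β₂ / d))) *
          ((b ^ k * ((1 - b / c) * (1 - b / d)) / ((1 - p₁ * b) * (1 - p₂ * b))) /
            (1 - q * β₁ / b)) := fun b => by
    have h := avg_two_poles (differentiableOn_div_one_sub_mul hp₁ hp₂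
      (f := fun a => a ^ k * ((1 - a / b) * (1 - a / c) * (1 - a / d))) (by fun_prop)) hq hβ
    have h' := congrArg (fun y => (1 - b / c : ℂ) * (1 - b / d) * (1 - c / d) *
      (flavorWeight k p₁ p₂ (q * β₁) (q * β₂) b * flavorWeight k p₁ p₂ (q * β₁) (q * β₂) c *
        flavorWeight k p₁ p₂ (q * β₁) (q * β₂) d) * y) h
    simp only [← avg_const_mul] at h'
    convert h' using 1
    · congr 1
      funext a
      simp only [weylU4, flavorWeight, zpow_natCast, div_eq_mul_inv, mul_inv]
      ring
    · generalize flavorWeight k p₁ p₂ (q * β₁) (q * β₂) c = C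
      generalize flavorWeight k p₁ p₂ (q * β₁) (q * β₂) d = D
      have h1 := hne β₁ b
      have h2 := hne β₂ b
      simp only [flavorWeight, zpow_natCast]
      generalize hs : 1 - q * β₁ / (b : ℂ) = s at *
      generalize ht : 1 - q * β₂ / (b : ℂ) = t at *
      rw [← mul_div_mul_left _ t h1, ← mul_div_mul_right _ s h2]
      simp only [div_eq_mul_inv, mul_inv]
      ring
  simp only [inner]
  have hdiff := differentiableOn_div_one_sub_mul hp₁ hp₂
      (f := fun b => b ^ k * ((1 - b / c) * (1 - b / d))) (by fun_prop)
  have hgc : Continuous fun b : Phase =>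
      (b : ℂ) ^ k * ((1 - b / c) * (1 - b / d)) / ((1 - p₁ * b) * (1 - p₂ * b)) :=
    hdiff.continuousOn.comp_continuous continuous_cis fun x => by simp
  have hc : ∀ β : Phase, Continuous fun b : Phase =>
      (b : ℂ) ^ k * ((1 - b / c) * (1 - b / d)) / ((1 - p₁ * b) * (1 - p₂ * b)) /
        (1 - q * β / b) := fun β =>
    hgc.div (by fun_prop (disch := exact hx0)) (hne β)
  rw [avg_linear_combination _ _ (hc _) (hc _), avg_one_pole hdiff (hn _),
    avg_one_pole hdiff (hn _)]
  have h₁ := hne β₁ c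
  have h₂ := hne β₂ c
  have h₃ := hne β₁ d
  have h₄ := hne β₂ d
  simp only [flavorWeight, zpow_natCast]
  generalize 1 - q * β₁ / (c : ℂ) = s₁ at *
  generalize 1 - q * β₂ / (c : ℂ) = s₂ at *
  generalize 1 - q * β₁ / (d : ℂ) = s₃ at *
  generalize 1 - q * β₂ / (d : ℂ) = s₄ at *
  rw [← mul_div_cancel_right₀ ((q * β₁ : ℂ) ^ k / ((1 - p₁ * (q * β₁)) * (1 - p₂ * (q * β₁))) *
      ((q * β₂) ^ k / ((1 - p₁ * (q * β₂)) * (1 - p₂ * (q * β₂)))) *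
      ((d : ℂ) ^ k / ((1 - p₁ * d) * (1 - p₂ * d)) *
        ((c : ℂ) ^ k * (1 - c / d) / ((1 - p₁ * c) * (1 - p₂ * c))))) hd,
    ← mul_div_cancel_right₀ (_ * (β₁ - β₂ : ℂ))
      (mul_ne_zero (mul_ne_zero h₁ h₂) (mul_ne_zero h₃ h₄))]
  simp only [div_eq_mul_inv, mul_inv]
  ring

theorem avg_weylU4 {p₁ p₂ q : ℂ} (hp₁ : ‖p₁‖ < 1) (hp₂ : ‖p₂‖ < 1) (hq : ‖q‖ < 1)
    {β₁ β₂ : Phase} (hβ : (β₁ : ℂ) ≠ β₂) (k : ℕ) :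
    (avg fun d => avg fun c => avg fun b => avg fun a => weylU4 a b c d *
      (flavorWeight k p₁ p₂ (q * β₁) (q * β₂) a * flavorWeight k p₁ p₂ (q * β₁) (q * β₂) b *
        flavorWeight k p₁ p₂ (q * β₁) (q * β₂) c * flavorWeight k p₁ p₂ (q * β₁) (q * β₂) d))
    = if k = 0 then ((1 - p₁ * (q * β₁)) * (1 - p₂ * (q * β₁)) *
        ((1 - p₁ * (q * β₂)) * (1 - p₂ * (q * β₂))))⁻¹ else 0 := by
  have inner : ∀ d : Phase, (avg fun c =>
      (c : ℂ) ^ k * (1 - c / d) / ((1 - p₁ * c) * (1 - p₂ * c))) = 0 ^ k := fun d => by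
    have := avg_of_differentiableOn (differentiableOn_div_one_sub_mul hp₁ hp₂
      (f := fun c => c ^ k * (1 - c / d)) (by fun_prop))
    simpa using this
  have outer : (avg fun d => (d : ℂ) ^ k / ((1 - p₁ * d) * (1 - p₂ * d))) = 0 ^ k := by
    have := avg_of_differentiableOn (differentiableOn_div_one_sub_mul hp₁ hp₂
      (f := fun d => d ^ k) (by fun_prop))
    simpa using this
  simp only [avg_avg_weylU4 hp₁ hp₂ hq hβ, avg_const_mul, inner, mul_comm _ ((0 : ℂ) ^ k), outer]
  split_ifs with h
  · subst h
    simp only [pow_zero, mul_one, one_div, mul_inv]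
  · simp [h]

theorem avg_reverse {f : Phase → Phase → Phase → Phase → ℂ}
    (hf : Continuous fun p : Phase × Phase × Phase × Phase => f p.1 p.2.1 p.2.2.1 p.2.2.2) :
    (avg fun a => avg fun b => avg fun c => avg fun d => f a b c d)
      = avg fun d => avg fun c => avg fun b => avg fun a => f a b c d := by
  have hf' : ∀ {X : Type} [TopologicalSpace X] {a b c d : X → Phase}, Continuous a →
      Continuous b → Continuous c → Continuous d →
      Continuous fun x => f (a x) (b x) (c x) (d x) := fun ha hb hc hd =>
    hf.comp (ha.prodMk (hb.prodMk (hc.prodMk hd)))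
  have rev : ∀ a, (avg fun b => avg fun c => avg fun d => f a b c d)
      = avg fun d => avg fun c => avg fun b => f a b c d := fun a => by
    have h : ∀ b, (avg fun c => avg fun d => f a b c d) = avg fun d => avg fun c => f a b c d :=
      fun b => avg_swap (hf' (by fun_prop) (by fun_prop) (by fun_prop) (by fun_prop))
    simp only [h]
    refine (avg_swap ?_).trans ?_
    · refine continuous_avg (hf' ?_ ?_ ?_ ?_) <;> fun_prop
    congr 1
    funext d
    exact avg_swap (hf' (by fun_prop) (by fun_prop) (by fun_prop) (by fun_prop))
  simp only [rev]
  refine (avg_swap ?_).trans ?_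
  · refine continuous_avg (continuous_avg (hf' ?_ ?_ ?_ ?_)) <;> fun_prop
  congr 1
  funext d
  refine (avg_swap ?_).trans ?_
  · refine continuous_avg (hf' ?_ ?_ ?_ ?_) <;> fun_prop
  congr 1
  funext c
  exact avg_swap (hf' (by fun_prop) (by fun_prop) (by fun_prop) (by fun_prop))

/-- Change of variables from partial sums of phases to the phases themselves. -/
theorem avg_partial_sums {f : Phase → Phase → Phase → Phase → ℂ}
    (hf : Continuous fun p : Phase × Phase × Phase × Phase => f p.1 p.2.1 p.2.2.1 p.2.2.2) :
    (avg fun s => avg fun a => avg fun b => avg fun c => f a (b - a) (c - b) (s - c))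
      = avg fun a => avg fun b => avg fun c => avg fun d => f a b c d := by
  have hf' : ∀ {X : Type} [TopologicalSpace X] {a b c d : X → Phase}, Continuous a →
      Continuous b → Continuous c → Continuous d →
      Continuous fun x => f (a x) (b x) (c x) (d x) := fun ha hb hc hd =>
    hf.comp (ha.prodMk (hb.prodMk (hc.prodMk hd)))
  refine (avg_swap ?_).trans ?_
  · refine continuous_avg (continuous_avg (hf' ?_ ?_ ?_ ?_)) <;> fun_prop
  congr 1
  funext a
  refine (avg_swap ?_).trans (Eq.trans ?_ (avg_sub_right _ a))
  · refine continuous_avg (hf' ?_ ?_ ?_ ?_) <;> fun_prop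
  congr 1
  funext b
  refine (avg_swap ?_).trans (Eq.trans ?_ (avg_sub_right _ b))
  · refine hf' ?_ ?_ ?_ ?_ <;> fun_prop
  congr 1
  funext c
  exact avg_sub_right _ c

/-- The `U(4)` integrand for two fundamental and two antifundamental flavours, twisted by the
`k`-th power of the determinant. -/
noncomputable def integrandU4 (k : ℤ) (p₁ p₂ q₁ q₂ a b c d : ℂ) : ℂ :=
  weylU4 a b c d * (flavorWeight k p₁ p₂ q₁ q₂ a * flavorWeight k p₁ p₂ q₁ q₂ b *
    flavorWeight k p₁ p₂ q₁ q₂ c * flavorWeight k p₁ p₂ q₁ q₂ d)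

theorem integrandU4_inv (k : ℤ) (p₁ p₂ q₁ q₂ a b c d : ℂ) :
    integrandU4 k p₁ p₂ q₁ q₂ a⁻¹ b⁻¹ c⁻¹ d⁻¹ = integrandU4 (-k) q₁ q₂ p₁ p₂ d c b a := by
  simp only [integrandU4, flavorWeight_inv, weylU4, inv_div_inv]
  ring

theorem zpow_mul_integrandU4 (k : ℤ) (p₁ p₂ q₁ q₂ a b c d : ℂ) :
    (a * b * c * d) ^ k * integrandU4 0 p₁ p₂ q₁ q₂ a b c d
      = integrandU4 k p₁ p₂ q₁ q₂ a b c d := by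
  simp only [integrandU4, flavorWeight, mul_zpow, zpow_zero]
  ring

theorem continuous_integrandU4 (k : ℤ) {p₁ p₂ q₁ q₂ : ℂ} (hp₁ : ‖p₁‖ < 1) (hp₂ : ‖p₂‖ < 1)
    (hq₁ : ‖q₁‖ < 1) (hq₂ : ‖q₂‖ < 1) {X : Type*} [TopologicalSpace X] {a b c d : X → Phase}
    (ha : Continuous a) (hb : Continuous b) (hc : Continuous c) (hd : Continuous d) :
    Continuous fun x => integrandU4 k p₁ p₂ q₁ q₂ (a x) (b x) (c x) (d x) := by
  have h := continuous_flavorWeight k hp₁ hp₂ hq₁ hq₂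
  have hx0 : ∀ x : Phase, (x : ℂ) ≠ 0 := cis_ne_zero
  unfold integrandU4 weylU4
  refine Continuous.mul (by fun_prop (disch := exact fun _ => hx0 _)) ?_
  exact (((h.comp ha).mul (h.comp hb)).mul (h.comp hc)).mul (h.comp hd)

/-- The four-variable integral of the `U(4)` integrand vanishes if the twist is nontrivial. -/
theorem avg_integrandU4 {t : ℂ} (ht : ‖t‖ < 1) {y w : Phase} (hy : (y : ℂ) ≠ (-y : Phase))
    (hw : (w : ℂ) ≠ (-w : Phase)) (k : ℤ) :
    (avg fun a => avg fun b => avg fun c => avg fun d =>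
      integrandU4 k (t * y) (t * (-y : Phase)) (t * w) (t * (-w : Phase)) a b c d)
    = if k = 0 then ((1 - t * y * (t * w)) * (1 - t * (-y : Phase) * (t * w)) *
        ((1 - t * y * (t * (-w : Phase))) * (1 - t * (-y : Phase) * (t * (-w : Phase)))))⁻¹
      else 0 := by
  have hn : ∀ β : Phase, ‖t * β‖ < 1 := fun β => by simpa using ht
  obtain ⟨n, rfl | rfl⟩ := k.eq_nat_or_neg
  · rw [avg_reverse (continuous_integrandU4 _ (hn _) (hn _) (hn _) (hn _) (by fun_prop)
      (by fun_prop) (by fun_prop) (by fun_prop))]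
    simp only [integrandU4, avg_weylU4 (hn _) (hn _) ht hw, Nat.cast_eq_zero]
  · have h : ∀ f : Phase → Phase → Phase → Phase → ℂ,
        (avg fun a => avg fun b => avg fun c => avg fun d => f a b c d) =
        avg fun a => avg fun b => avg fun c => avg fun d => f (-a) (-b) (-c) (-d) := fun f => by
      rw [← avg_neg]
      congr 1; funext a
      rw [← avg_neg]
      congr 1; funext b
      rw [← avg_neg]
      congr 1; funext c
      rw [← avg_neg]
    rw [h]
    simp only [cis_neg _, integrandU4_inv, neg_neg]
    have := avg_weylU4 (hn w) (hn (-w)) ht hy n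
    simp only [cis_neg, integrandU4] at this ⊢
    rw [this]
    simp only [neg_eq_zero, Nat.cast_eq_zero]
    congr 2
    ring

/-- The `SU(4)` integral, in terms of the partial sums of the eigenvalue phases. -/
theorem avg_integrandSU4 {t : ℂ} (ht : ‖t‖ < 1) {y w : Phase} (hy : (y : ℂ) ≠ (-y : Phase))
    (hw : (w : ℂ) ≠ (-w : Phase)) :
    (avg fun a => avg fun b => avg fun c => integrandU4 0 (t * y) (t * (-y : Phase))
      (t * w) (t * (-w : Phase)) a (b - a : Phase) (c - b : Phase) (0 - c : Phase))
    = ((1 - t * y * (t * w)) * (1 - t * (-y : Phase) * (t * w)) *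
        ((1 - t * y * (t * (-w : Phase))) * (1 - t * (-y : Phase) * (t * (-w : Phase)))))⁻¹ := by
  have hn : ∀ β : Phase, ‖t * β‖ < 1 := fun β => by simpa using ht
  have hcont : ∀ k, Continuous fun p : Phase × Phase × Phase × Phase =>
      integrandU4 k (t * y) (t * (-y : Phase)) (t * w) (t * (-w : Phase)) p.1 p.2.1 p.2.2.1
        p.2.2.2 := fun k => continuous_integrandU4 k (hn _) (hn _) (hn _) (hn _) (by fun_prop)
      (by fun_prop) (by fun_prop) (by fun_prop)
  have hsum := fun k => (avg_partial_sums (hcont k)).trans (avg_integrandU4 ht hy hw k)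
  have hJ := eq_avg_of_zpow_avg_eq_zero (f := fun s => avg fun a => avg fun b => avg fun c =>
    integrandU4 0 (t * y) (t * (-y : Phase)) (t * w) (t * (-w : Phase)) a (b - a : Phase)
      (c - b : Phase) (s - c : Phase)) ?_ fun n hn0 => ?_
  · simpa using hJ.trans (hsum 0)
  · exact continuous_avg (continuous_avg (continuous_avg (continuous_integrandU4 _ (hn _) (hn _)
      (hn _) (hn _) (by fun_prop) (by fun_prop) (by fun_prop) (by fun_prop))))
  · have h := hsum n
    rw [if_neg hn0] at h
    rw [← h]
    congr 1
    funext s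
    simp only [← avg_const_mul]
    congr 1; funext a; congr 1; funext b; congr 1; funext c
    rw [← zpow_mul_integrandU4 n]
    simp [mul_div_cancel₀, cis_ne_zero]

theorem avg_eq_zero_of_odd {f : Phase → ℂ} (hf : ∀ x, f (-x) = -f x) : avg f = 0 := by
  have h : avg (fun x => f (-x)) = -avg f := by
    simpa only [hf, neg_one_mul] using avg_const_mul (-1) f
  rw [avg_neg] at h
  linear_combination (1 / 2) * h

/-- The first of the two `SU(2)` integrals, after the `SU(4)` integral has been evaluated. -/
theorem avg_SU2 (u : ℂ) {q : ℂ} (hq : ‖q‖ < 1) {z : Phase} (hz : (z : ℂ) ≠ (-z : Phase)) :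
    (avg fun w => (1 - (w : ℂ) ^ 2) *
      ((1 - u * (z * w)) * (1 - u * (z / w)) * (1 - u * (w / z)) * (1 - u * (1 / (z * w))) /
        ((1 - q * z * w) * (1 - q * (-z : Phase) * w) *
          ((1 - q * z / w) * (1 - q * (-z : Phase) / w)))))
    = (1 + u ^ 4 - u ^ 2 * (1 + q ^ 2)) / (1 - q ^ 2) +
      (u ^ 2 * (1 + q ^ 2) - q * (u + u ^ 3)) / (1 - q ^ 2) * (z + 1 / z : ℂ) ^ 2 := by
  have hx0 : ∀ x : Phase, (x : ℂ) ≠ 0 := cis_ne_zero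
  have hn : ∀ β : Phase, ‖q * β‖ < 1 := fun β => by simpa using hq
  have hD : ∀ w : Phase, (1 - q * z * w) * (1 - q * (-z : Phase) * w) *
      ((1 - q * z / w) * (1 - q * (-z : Phase) / w)) ≠ 0 := fun w =>
    mul_ne_zero (mul_ne_zero (one_sub_mul_cis_ne_zero (hn _) w)
      (one_sub_mul_cis_ne_zero (hn _) w)) (mul_ne_zero (one_sub_div_cis_ne_zero (hn _) w)
      (one_sub_div_cis_ne_zero (hn _) w))
  let χ : ℂ := z + 1 / z
  let P : ℂ → ℂ := fun w => (1 + u ^ 4 + u ^ 2 * (χ ^ 2 - 2)) * (1 - w ^ 2) -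
    (u + u ^ 3) * χ * (w - w ^ 3) + u ^ 2 * (1 - w ^ 4)
  let R : ℂ → ℂ := fun w => -(u + u ^ 3) * χ * (1 / w - w) + u ^ 2 * (1 / w ^ 2 - w ^ 2)
  let D : ℂ → ℂ := fun w => (1 - q * z * w) * (1 - q * (-z : Phase) * w) *
    ((1 - q * z / w) * (1 - q * (-z : Phase) / w))
  have hsplit : ∀ w : Phase, (1 - (w : ℂ) ^ 2) *
      ((1 - u * (z * w)) * (1 - u * (z / w)) * (1 - u * (w / z)) * (1 - u * (1 / (z * w))) /
        ((1 - q * z * w) * (1 - q * (-z : Phase) * w) *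
          ((1 - q * z / w) * (1 - q * (-z : Phase) / w)))) = P w / D w + R w / D w := fun w => by
    rw [← mul_div_assoc, ← add_div]
    congr 1
    simp only [P, R, χ]
    have := hx0 z
    have := hx0 w
    field_simp
    ring
  have hDc : Continuous fun w : Phase => D w := by
    simp only [D]
    fun_prop (disch := exact hx0)
  have hodd : (avg fun w => R w / D w) = 0 := avg_eq_zero_of_odd fun w => by
    rw [← neg_div]
    congr 1
    · simp only [R, cis_neg, one_div, inv_inv, inv_pow]
      ring
    · simp only [D, cis_neg, div_inv_eq_mul, ← div_eq_mul_inv]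
      ring
  have hpole := avg_two_poles (differentiableOn_div_one_sub_mul (hn z) (hn (-z)) (f := P)
    (by fun_prop)) hq hz
  have hPR : (avg fun w => P w / D w + R w / D w)
      = (avg fun w => P w / D w) + avg fun w => R w / D w := by
    refine avg_add ?_ ?_
    · exact Continuous.div (by fun_prop) hDc hD
    · refine Continuous.div ?_ hDc hD
      simp only [R]
      fun_prop (disch := simp)
  simp only [hsplit, hPR, hodd, add_zero]
  simp only [div_div] at hpole
  refine hpole.trans ?_
  simp only [P, χ, cis_neg] at hz ⊢
  have hz0 := hx0 z
  have hz1 : (z : ℂ) ^ 2 - 1 ≠ 0 := fun h => hz (by field_simp; linear_combination h)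
  have hq2 : ‖q ^ 2‖ < 1 := by
    rw [norm_pow]
    exact pow_lt_one₀ (norm_nonneg q) hq two_ne_zero
  have h1 : 1 - q ^ 2 ≠ 0 := one_sub_ne_zero_of_norm_lt hq2
  have h2 : 1 - z ^ 2 * q ^ 2 ≠ 0 := one_sub_ne_zero_of_norm_lt (by simpa using hq2)
  have h3 : (z : ℂ) ^ 2 - q ^ 2 ≠ 0 := fun h => by
    have := one_sub_ne_zero_of_norm_lt (a := q ^ 2 / z ^ 2) (by simpa using hq2)
    rw [one_sub_div (pow_ne_zero 2 hz0)] at this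
    exact this (by rw [h, zero_div])
  generalize (z : ℂ) = y at *
  have e1 : (1 - q * y * (q * y)) * (1 - q * y⁻¹ * (q * y))
      = (1 - y ^ 2 * q ^ 2) * (1 - q ^ 2) := by
    field_simp
  have e2 : (1 - q * y * (q * y⁻¹)) * (1 - q * y⁻¹ * (q * y⁻¹))
      = (1 - q ^ 2) * ((y ^ 2 - q ^ 2) / y ^ 2) := by
    field_simp
  have e3 : y - y⁻¹ = (y ^ 2 - 1) / y := by field_simp
  rw [e1, e2, e3]
  field_simp
  ring

/-- The second `SU(2)` integral. -/
theorem avg_SU2_character_sq (A B : ℂ) :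
    (avg fun z => (1 - (z : ℂ) ^ 2) * (A + B * (z + 1 / z : ℂ) ^ 2)) = A + B := by
  have hx0 : ∀ x : Phase, (x : ℂ) ≠ 0 := cis_ne_zero
  have hsplit : ∀ z : Phase, (1 - (z : ℂ) ^ 2) * (A + B * (z + 1 / z : ℂ) ^ 2)
      = (A * (1 - (z : ℂ) ^ 2) + B * (1 - (z : ℂ) ^ 4)) + B * (1 / (z : ℂ) ^ 2 - (z : ℂ) ^ 2) :=
    fun z => by
    have := hx0 z
    field_simp
    ring
  simp only [hsplit]
  have hodd : (avg fun z => B * (1 / (z : ℂ) ^ 2 - (z : ℂ) ^ 2)) = 0 :=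
    avg_eq_zero_of_odd fun z => by
      simp only [cis_neg, one_div, inv_pow, inv_inv]
      ring
  rw [avg_add (f := fun z => A * (1 - (z : ℂ) ^ 2) + B * (1 - (z : ℂ) ^ 4)) (by fun_prop)
    (by fun_prop (disch := simp)), hodd, add_zero,
    avg_of_differentiableOn (g := fun z => A * (1 - z ^ 2) + B * (1 - z ^ 4)) (by fun_prop)]
  simp

theorem muSU4_eq_weylU4 {z₁ z₂ z₃ : ℂ} (h₁ : z₁ ≠ 0) (h₂ : z₂ ≠ 0) (h₃ : z₃ ≠ 0) :
    muSU4 z₁ z₂ z₃ = weylU4 z₁ (z₂ / z₁) (z₃ / z₂) (1 / z₃) := by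
  unfold muSU4 weylU4
  field_simp

theorem muSU4_mul_PE {z₁ z₂ z₃ : ℂ} (h₁ : z₁ ≠ 0) (h₂ : z₂ ≠ 0) (h₃ : z₃ ≠ 0) (t F z w : ℂ) :
    muSU4 z₁ z₂ z₃ * (F *
      PE_B t [z₁ * z, z₁ / z, z₂ * z / z₁, z₂ / (z₁ * z),
        z₃ * z / z₂, z₃ / (z₂ * z), z / z₃, 1 / (z₃ * z)] *
      PE_B t [z₃ * w, z₃ / w, z₂ * w / z₃, z₂ / (z₃ * w),
        z₁ * w / z₂, z₁ / (z₂ * w), w / z₁, 1 / (z₁ * w)])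
    = F * integrandU4 0 (t * z) (t * z⁻¹) (t * w) (t * w⁻¹) z₁ (z₂ / z₁) (z₃ / z₂) (1 / z₃) := by
  rw [muSU4_eq_weylU4 h₁ h₂ h₃]
  simp only [integrandU4, flavorWeight, PE_B, List.map_cons, List.map_nil, List.prod_cons,
    List.prod_nil, mul_inv, zpow_zero, div_eq_mul_inv, inv_inv, one_mul, mul_one]
  ring

theorem avg_muSU4 {t : ℂ} (ht : ‖t‖ < 1) (F : ℂ) {z w : Phase} (hz : (z : ℂ) ≠ (-z : Phase))
    (hw : (w : ℂ) ≠ (-w : Phase)) :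
    (avg fun z₁ => avg fun z₂ => avg fun z₃ => muSU4 z₁ z₂ z₃ * (F *
      PE_B t [z₁ * z, z₁ / z, z₂ * z / z₁, z₂ / (z₁ * z),
        z₃ * z / z₂, z₃ / (z₂ * z), z / z₃, 1 / (z₃ * z)] *
      PE_B t [z₃ * w, z₃ / w, z₂ * w / z₃, z₂ / (z₃ * w),
        z₁ * w / z₂, z₁ / (z₂ * w), w / z₁, 1 / (z₁ * w)]))
    = F / ((1 - t ^ 2 * z * w) * (1 - t ^ 2 * (-z : Phase) * w) *
        ((1 - t ^ 2 * z / w) * (1 - t ^ 2 * (-z : Phase) / w))) := by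
  have h := avg_integrandSU4 ht hz hw
  simp only [cis_sub, cis_neg, cis_zero] at h
  simp only [muSU4_mul_PE (cis_ne_zero _) (cis_ne_zero _) (cis_ne_zero _), avg_const_mul, h]
  simp only [cis_neg, mul_inv, div_eq_mul_inv]
  ring

theorem one_sub_cis_sq_eq_zero {z : Phase} (hz : (z : ℂ) = (-z : Phase)) :
    1 - (z : ℂ) ^ 2 = 0 := by
  rw [cis_neg] at hz
  rw [pow_two]
  nth_rw 2 [hz]
  simp

/-- Hilbert–Poincaré series of `(SO(4)×SU(4))`-invariant form polynomials for
`D=4`, `N=4` flat superspace. -/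
theorem statement_4 (t u : ℂ) (ht : ‖t‖ < 1) (hu : ‖u‖ < 1) :
    (nint fun z => (1 - z ^ 2) *
      nint fun w => (1 - w ^ 2) *
        nint fun z₁ => nint fun z₂ => nint fun z₃ => muSU4 z₁ z₂ z₃ *
          (PE_F u [z * w, z / w, w / z, 1 / (z * w)] *
           PE_B t [z₁ * z, z₁ / z, z₂ * z / z₁, z₂ / (z₁ * z),
                   z₃ * z / z₂, z₃ / (z₂ * z), z / z₃, 1 / (z₃ * z)] *
           PE_B t [z₃ * w, z₃ / w, z₂ * w / z₃, z₂ / (z₃ * w),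
                   z₁ * w / z₂, z₁ / (z₂ * w), w / z₁, 1 / (z₁ * w)]))
      = (1 - t ^ 2 * (u + u ^ 3) + u ^ 4) / (1 - t ^ 4) := by
  have ht2 : ‖t ^ 2‖ < 1 := by
    rw [norm_pow]
    exact pow_lt_one₀ (norm_nonneg t) ht two_ne_zero
  have hSU2 : ∀ z : Phase, (1 - (z : ℂ) ^ 2) * (avg fun w => (1 - (w : ℂ) ^ 2) *
      avg fun z₁ => avg fun z₂ => avg fun z₃ => muSU4 z₁ z₂ z₃ *
        (PE_F u [z * w, z / w, w / z, 1 / (z * w)] *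
          PE_B t [z₁ * z, z₁ / z, z₂ * z / z₁, z₂ / (z₁ * z),
            z₃ * z / z₂, z₃ / (z₂ * z), z / z₃, 1 / (z₃ * z)] *
          PE_B t [z₃ * w, z₃ / w, z₂ * w / z₃, z₂ / (z₃ * w),
            z₁ * w / z₂, z₁ / (z₂ * w), w / z₁, 1 / (z₁ * w)]))
      = (1 - (z : ℂ) ^ 2) * ((1 + u ^ 4 - u ^ 2 * (1 + (t ^ 2) ^ 2)) / (1 - (t ^ 2) ^ 2) +
        (u ^ 2 * (1 + (t ^ 2) ^ 2) - t ^ 2 * (u + u ^ 3)) / (1 - (t ^ 2) ^ 2) *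
          (z + 1 / z : ℂ) ^ 2) := fun z => by
    by_cases hz : (z : ℂ) = (-z : Phase)
    · rw [one_sub_cis_sq_eq_zero hz, zero_mul, zero_mul]
    rw [← avg_SU2 u ht2 hz]
    congr 2
    funext w
    by_cases hw : (w : ℂ) = (-w : Phase)
    · rw [one_sub_cis_sq_eq_zero hw, zero_mul, zero_mul]
    rw [avg_muSU4 ht _ hz hw]
    simp only [PE_F, List.map_cons, List.map_nil, List.prod_cons, List.prod_nil, mul_one,
      mul_assoc]
  simp only [nint_eq_avg, hSU2, avg_SU2_character_sq]
  rw [← add_div]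
  ring
end

section
/- Let t ∈ ℂ with ‖t‖ < 1 and let z, w ∈ ℂ with |z| = |w| = 1, with all denominators below nonvanishing. Then the normalized contour integral over |x| = 1, against the measure (1 − x²) dx/(2πi x), of PE_F[z² + 1 + 1/z²; t] · PE_F[w² + 1 + 1/w²; t] · PE_B[xwz + xw/z + wz/x + xz/w + x/(wz) + z/(wx) + w/(xz) + 1/(xwz); t] equals (1 − t⁴)(1 − z²t)(1 − t)²(1 − t/z²)(1 − w²t)(1 − t/w²) / [(1 − t²)²(1 − t²w²)(1 − t²/w²)(1 − t²z²)(1 − t²/z²)]. This is the Hilbert–Poincaré series of SO(3)-invariant form polynomials for the supercoset OSp(4|2)/SO(3), whose bosonic sector is AdS₃ × S³. -/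
open Complex Metric Real in
/-- Mean value property for `h` holomorphic on the closed unit disc, applied to both `h` and
`x ↦ h x⁻¹`. -/
lemma circleAverage_add_comp_inv {h : ℂ → ℂ} (hh : DifferentiableOn ℂ h (closedBall 0 1)) :
    circleAverage (fun x => h x + h x⁻¹) 0 1 = 2 * h 0 := by
  have hc : ContinuousOn h (sphere 0 1) := hh.continuousOn.mono sphere_subset_closedBall
  have hinv : ContinuousOn (fun x : ℂ => h x⁻¹) (sphere 0 1) := by
    refine hc.comp (continuousOn_inv₀.mono fun x hx => ?_) fun x hx => ?_
    · exact ne_of_mem_sphere hx one_ne_zero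
    · simpa using hx
  have h0 : circleAverage h 0 1 = h 0 := by
    apply DiffContOnCl.circleAverage
    apply DifferentiableOn.diffContOnCl
    simpa [closure_ball] using hh
  rw [circleAverage_fun_add (hc.circleIntegrable zero_le_one)
    (hinv.circleIntegrable zero_le_one), circleAverage_zero_one_congr_inv (f := h), h0]
  ring

open Complex Metric Real in
/-- Torus integral formula for the `SL₂`-invariants of four doublets, in terms of the elementary
symmetric functions `p, q, r, s` of the four fugacities. -/
lemma circleAverage_palindromic_quartic (p q r s : ℂ)
    (hP : ∀ x : ℂ, ‖x‖ ≤ 1 → 1 - p * x + q * x ^ 2 - r * x ^ 3 + s * x ^ 4 ≠ 0) :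
    (1 - s - s ^ 2 + s ^ 3 - r ^ 2 - q + 2 * q * s - q * s ^ 2 + p * r + p * r * s - p ^ 2 * s) *
      circleAverage (fun x => (1 - x ^ 2) * ((1 - p * x + q * x ^ 2 - r * x ^ 3 + s * x ^ 4) *
        (1 - p * x⁻¹ + q * x⁻¹ ^ 2 - r * x⁻¹ ^ 3 + s * x⁻¹ ^ 4))⁻¹) 0 1 = 1 - s := by
  set D := 1 - s - s ^ 2 + s ^ 3 - r ^ 2 - q + 2 * q * s - q * s ^ 2 + p * r + p * r * s - p ^ 2 * s
    with hD
  set f : ℂ → ℂ := fun x => (1 - x ^ 2) * ((1 - p * x + q * x ^ 2 - r * x ^ 3 + s * x ^ 4) *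
    (1 - p * x⁻¹ + q * x⁻¹ ^ 2 - r * x⁻¹ ^ 3 + s * x⁻¹ ^ 4))⁻¹ with hf
  set g : ℂ → ℂ := fun x => ((1 - s) - (r - p * s) * (x - x ^ 3) - (1 - s) ^ 2 * x ^ 2
    - s * (1 - s) * x ^ 4) / (1 - p * x + q * x ^ 2 - r * x ^ 3 + s * x ^ 4) with hg
  have hinv : ∀ x ∈ sphere (0 : ℂ) 1, ‖x⁻¹‖ ≤ 1 := fun x hx => by
    simp [mem_sphere_zero_iff_norm.1 hx]
  have hfc : ContinuousOn f (sphere 0 1) := by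
    intro x hx
    have hx0 : x ≠ 0 := ne_of_mem_sphere hx one_ne_zero
    have h1 := hP x (mem_sphere_zero_iff_norm.1 hx).le
    have h2 := hP x⁻¹ (hinv x hx)
    apply ContinuousAt.continuousWithinAt
    fun_prop (disch := first | assumption | exact mul_ne_zero h1 h2)
  have hfci : ContinuousOn (fun x => f x⁻¹) (sphere 0 1) := by
    refine hfc.comp (continuousOn_inv₀.mono fun x hx => ?_) fun x hx => ?_
    · exact ne_of_mem_sphere hx one_ne_zero
    · simpa using hx
  have hgd : DifferentiableOn ℂ g (closedBall 0 1) := by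
    intro x hx
    have h1 := hP x (by simpa using hx)
    apply DifferentiableAt.differentiableWithinAt
    fun_prop (disch := assumption)
  have hsum : circleAverage (fun x => D • (f x + f x⁻¹)) 0 1
      = circleAverage (fun x => g x + g x⁻¹) 0 1 := by
    refine circleAverage_congr_sphere fun x hx => ?_
    rw [abs_one] at hx
    have hx0 : x ≠ 0 := ne_of_mem_sphere hx one_ne_zero
    have h1 := hP x (mem_sphere_zero_iff_norm.1 hx).le
    have h2 := hP x⁻¹ (hinv x hx)
    have hbez : D * ((1 - x ^ 2) + (1 - x⁻¹ ^ 2)) =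
        ((1 - s) - (r - p * s) * (x - x ^ 3) - (1 - s) ^ 2 * x ^ 2 - s * (1 - s) * x ^ 4) *
          (1 - p * x⁻¹ + q * x⁻¹ ^ 2 - r * x⁻¹ ^ 3 + s * x⁻¹ ^ 4) +
        (1 - p * x + q * x ^ 2 - r * x ^ 3 + s * x ^ 4) * ((1 - s) - (r - p * s) * (x⁻¹ - x⁻¹ ^ 3)
          - (1 - s) ^ 2 * x⁻¹ ^ 2 - s * (1 - s) * x⁻¹ ^ 4) := by
      rw [hD]
      field_simp
      ring
    have hc := inv_mul_cancel₀ (mul_ne_zero h1 h2)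
    simp only [hf, hg, inv_inv, smul_eq_mul]
    rw [div_add_div _ _ h1 h2, eq_div_iff (mul_ne_zero h1 h2),
      mul_comm (1 - p * x⁻¹ + q * x⁻¹ ^ 2 - r * x⁻¹ ^ 3 + s * x⁻¹ ^ 4), ← hbez, ← add_mul,
      mul_assoc, mul_assoc, hc, mul_one]
  rw [circleAverage_fun_smul, circleAverage_fun_add (hfc.circleIntegrable zero_le_one)
    (hfci.circleIntegrable zero_le_one), circleAverage_zero_one_congr_inv (f := f),
    circleAverage_add_comp_inv hgd] at hsum
  have hg0 : g 0 = 1 - s := by simp [hg]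
  rw [hg0, smul_eq_mul] at hsum
  linear_combination hsum / 2

lemma nint_eq_circleAverage (f : ℂ → ℂ) : nint f = Real.circleAverage f 0 1 := by
  rw [Real.circleAverage_eq_circleIntegral one_ne_zero, nint, cint]
  simp [div_eq_inv_mul]

/-- Hilbert–Poincaré series of `SO(3)`-invariant form polynomials for the
supercoset `OSp(4|2)/SO(3)`, whose bosonic sector is `AdS₃ × S³`. -/
theorem statement_12 (t z w : ℂ) (ht : ‖t‖ < 1) (hz : ‖z‖ = 1) (hw : ‖w‖ = 1)
    (hd1 : 1 - t ^ 2 ≠ 0) (hd2 : 1 - t ^ 2 * w ^ 2 ≠ 0) (hd3 : 1 - t ^ 2 / w ^ 2 ≠ 0)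
    (hd4 : 1 - t ^ 2 * z ^ 2 ≠ 0) (hd5 : 1 - t ^ 2 / z ^ 2 ≠ 0) :
    (nint fun x => (1 - x ^ 2) *
      (PE_F t [z ^ 2, 1, 1 / z ^ 2] * PE_F t [w ^ 2, 1, 1 / w ^ 2] *
       PE_B t [x * w * z, x * w / z, w * z / x, x * z / w,
               x / (w * z), z / (w * x), w / (x * z), 1 / (x * w * z)]))
      = (1 - t ^ 4) * (1 - z ^ 2 * t) * (1 - t) ^ 2 * (1 - t / z ^ 2) *
          (1 - w ^ 2 * t) * (1 - t / w ^ 2) /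
        ((1 - t ^ 2) ^ 2 * (1 - t ^ 2 * w ^ 2) * (1 - t ^ 2 / w ^ 2) *
          (1 - t ^ 2 * z ^ 2) * (1 - t ^ 2 / z ^ 2)) := by
  have hz0 : z ≠ 0 := by rintro rfl; simp at hz
  have hw0 : w ≠ 0 := by rintro rfl; simp at hw
  have hne : ∀ a x : ℂ, ‖a‖ = 1 → ‖x‖ ≤ 1 → 1 - t * a * x ≠ 0 := by
    intro a x ha hx h
    have h1 : ‖t * a * x‖ = 1 := by rw [← sub_eq_zero.1 h, norm_one]
    rw [norm_mul, norm_mul, ha, mul_one] at h1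
    nlinarith [norm_nonneg t, norm_nonneg x]
  have hfac : ∀ x : ℂ, 1 - t * (w + w⁻¹) * (z + z⁻¹) * x
      + t ^ 2 * (w ^ 2 + z ^ 2 + 2 + w⁻¹ ^ 2 + z⁻¹ ^ 2) * x ^ 2
      - t ^ 3 * (w + w⁻¹) * (z + z⁻¹) * x ^ 3 + t ^ 4 * x ^ 4
      = (1 - t * (w * z) * x) * (1 - t * (w * z⁻¹) * x) * (1 - t * (w⁻¹ * z) * x)
        * (1 - t * (w⁻¹ * z⁻¹) * x) := by
    intro x
    field_simp
    ring
  have key := circleAverage_palindromic_quartic (t * (w + w⁻¹) * (z + z⁻¹))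
    (t ^ 2 * (w ^ 2 + z ^ 2 + 2 + w⁻¹ ^ 2 + z⁻¹ ^ 2)) (t ^ 3 * (w + w⁻¹) * (z + z⁻¹)) (t ^ 4)
    (fun x hx => by
      rw [hfac]
      refine mul_ne_zero (mul_ne_zero (mul_ne_zero ?_ ?_) ?_) ?_ <;>
        exact hne _ _ (by simp [hz, hw]) hx)
  have hint : (fun x : ℂ => (1 - x ^ 2) *
      (PE_F t [z ^ 2, 1, 1 / z ^ 2] * PE_F t [w ^ 2, 1, 1 / w ^ 2] *
       PE_B t [x * w * z, x * w / z, w * z / x, x * z / w,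
               x / (w * z), z / (w * x), w / (x * z), 1 / (x * w * z)])) =
      fun x => (PE_F t [z ^ 2, 1, 1 / z ^ 2] * PE_F t [w ^ 2, 1, 1 / w ^ 2]) •
        ((1 - x ^ 2) * ((1 - t * (w + w⁻¹) * (z + z⁻¹) * x
      + t ^ 2 * (w ^ 2 + z ^ 2 + 2 + w⁻¹ ^ 2 + z⁻¹ ^ 2) * x ^ 2
      - t ^ 3 * (w + w⁻¹) * (z + z⁻¹) * x ^ 3 + t ^ 4 * x ^ 4) *
        (1 - t * (w + w⁻¹) * (z + z⁻¹) * x⁻¹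
      + t ^ 2 * (w ^ 2 + z ^ 2 + 2 + w⁻¹ ^ 2 + z⁻¹ ^ 2) * x⁻¹ ^ 2
      - t ^ 3 * (w + w⁻¹) * (z + z⁻¹) * x⁻¹ ^ 3 + t ^ 4 * x⁻¹ ^ 4))⁻¹) := by
    funext x
    have hB : PE_B t [x * w * z, x * w / z, w * z / x, x * z / w,
        x / (w * z), z / (w * x), w / (x * z), 1 / (x * w * z)] =
        (((1 - t * (w * z) * x) * (1 - t * (w * z⁻¹) * x) * (1 - t * (w⁻¹ * z) * x)
        * (1 - t * (w⁻¹ * z⁻¹) * x)) * ((1 - t * (w * z) * x⁻¹) * (1 - t * (w * z⁻¹) * x⁻¹)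
        * (1 - t * (w⁻¹ * z) * x⁻¹) * (1 - t * (w⁻¹ * z⁻¹) * x⁻¹)))⁻¹ := by
      have e1 : x * w * z = w * z * x := by ring
      have e2 : x * w / z = w * z⁻¹ * x := by ring
      have e3 : w * z / x = w * z * x⁻¹ := by ring
      have e4 : x * z / w = w⁻¹ * z * x := by ring
      have e5 : x / (w * z) = w⁻¹ * z⁻¹ * x := by rw [div_eq_mul_inv, mul_inv]; ring
      have e6 : z / (w * x) = w⁻¹ * z * x⁻¹ := by rw [div_eq_mul_inv, mul_inv]; ring
      have e7 : w / (x * z) = w * z⁻¹ * x⁻¹ := by rw [div_eq_mul_inv, mul_inv]; ring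
      have e8 : 1 / (w * z * x) = w⁻¹ * z⁻¹ * x⁻¹ := by rw [one_div, mul_inv, mul_inv]
      rw [e1, e2, e3, e4, e5, e6, e7, e8]
      simp only [PE_B, List.map_cons, List.map_nil, List.prod_cons, List.prod_nil]
      congr 1
      simp only [mul_assoc t]
      generalize 1 - t * (w * z * x) = a1
      generalize 1 - t * (w * z⁻¹ * x) = a2
      generalize 1 - t * (w * z * x⁻¹) = a3
      generalize 1 - t * (w⁻¹ * z * x) = a4
      generalize 1 - t * (w⁻¹ * z⁻¹ * x) = a5
      generalize 1 - t * (w⁻¹ * z * x⁻¹) = a6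
      generalize 1 - t * (w * z⁻¹ * x⁻¹) = a7
      generalize 1 - t * (w⁻¹ * z⁻¹ * x⁻¹) = a8
      ring
    rw [hfac, hfac, hB, smul_eq_mul]
    ac_rfl
  rw [nint_eq_circleAverage, hint, Real.circleAverage_fun_smul, smul_eq_mul]
  have hF : PE_F t [z ^ 2, 1, 1 / z ^ 2] * PE_F t [w ^ 2, 1, 1 / w ^ 2] =
      (1 - z ^ 2 * t) * (1 - t) ^ 2 * (1 - t / z ^ 2) * (1 - w ^ 2 * t) * (1 - t / w ^ 2) := by
    simp only [PE_F, List.map_cons, List.map_nil, List.prod_cons, List.prod_nil]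
    ring
  rw [hF, eq_div_iff (by simp [hd1, hd2, hd3, hd4, hd5])]
  have hDen : (1 - t ^ 2) ^ 2 * (1 - t ^ 2 * w ^ 2) * (1 - t ^ 2 / w ^ 2) *
      (1 - t ^ 2 * z ^ 2) * (1 - t ^ 2 / z ^ 2) = 1 - t ^ 4 - (t ^ 4) ^ 2 + (t ^ 4) ^ 3
      - (t ^ 3 * (w + w⁻¹) * (z + z⁻¹)) ^ 2 - t ^ 2 * (w ^ 2 + z ^ 2 + 2 + w⁻¹ ^ 2 + z⁻¹ ^ 2)
      + 2 * (t ^ 2 * (w ^ 2 + z ^ 2 + 2 + w⁻¹ ^ 2 + z⁻¹ ^ 2)) * t ^ 4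
      - t ^ 2 * (w ^ 2 + z ^ 2 + 2 + w⁻¹ ^ 2 + z⁻¹ ^ 2) * (t ^ 4) ^ 2
      + t * (w + w⁻¹) * (z + z⁻¹) * (t ^ 3 * (w + w⁻¹) * (z + z⁻¹))
      + t * (w + w⁻¹) * (z + z⁻¹) * (t ^ 3 * (w + w⁻¹) * (z + z⁻¹)) * t ^ 4
      - (t * (w + w⁻¹) * (z + z⁻¹)) ^ 2 * t ^ 4 := by
    field_simp
    ring
  rw [mul_assoc, hDen, mul_comm (Real.circleAverage _ _ _), key]
  ring
end

section
/- Let t, u ∈ ℂ with 0 < ‖t‖ < 1, 0 < ‖u‖ < 1. Define F(z,w) = u^{-1}(z+1/z)(w+1/w) − t^{-1}(z+1/z) − t^{-1}(w+1/w) + (z² + 1 + 1/z²) + (w² + 1 + 1/w²). Then the iterated normalized contour integral over |z| = 1 and |w| = 1, each against dμ_{SU(2)}, of F(z,w) · PE_F[(z+1/z)(w+1/w); u] · PE_B[z+1/z; t] · PE_B[w+1/w; t] equals −2t⁴u³ + 3t⁴u² − t⁴ + 2t²u⁴ + t²u³ − 4t²u² + 2t²u + t²/u − 2u⁴ + 2u³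 − u² + 2u − 3. This is the Hilbert–Poincaré series counting Lorentz-invariant Spencer cochains linear in the D=4, N=1 super-Poincaré generators. -/
theorem cint_congr {f g : ℂ → ℂ} (h : ∀ z, ‖z‖ = 1 → f z = g z) : cint f = cint g := by
  unfold cint
  rw [circleIntegral.integral_congr zero_le_one]
  intro z hz
  exact h z (by simpa using hz)

theorem cint_const_mul (a : ℂ) (f : ℂ → ℂ) : cint (fun z => a * f z) = a * cint f := by
  simp only [cint, circleIntegral.integral_const_mul]
  ring

theorem circleIntegrable_of_continuousAt {f : ℂ → ℂ} (hf : ∀ z, ‖z‖ = 1 → ContinuousAt f z) :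
    CircleIntegrable f 0 1 := by
  refine ContinuousOn.circleIntegrable zero_le_one fun z hz => ?_
  exact (hf z (by simpa using hz)).continuousWithinAt

theorem cint_add {f g : ℂ → ℂ} (hf : ∀ z, ‖z‖ = 1 → ContinuousAt f z)
    (hg : ∀ z, ‖z‖ = 1 → ContinuousAt g z) :
    cint (fun z => f z + g z) = cint f + cint g := by
  simp only [cint]
  rw [circleIntegral.integral_add (circleIntegrable_of_continuousAt hf)
    (circleIntegrable_of_continuousAt hg), mul_add]

theorem cint_zpow {n : ℤ} (hn : n ≠ -1) : cint (fun z => z ^ n) = 0 := by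
  have h := circleIntegral.integral_sub_zpow_of_ne hn 0 0 1
  simp only [sub_zero] at h
  simp [cint, h]

theorem cint_inv : cint (fun z => z ^ (-1 : ℤ)) = 1 := by
  have h := circleIntegral.integral_sub_center_inv 0 (one_ne_zero : (1 : ℝ) ≠ 0)
  simp only [sub_zero] at h
  simp only [cint, zpow_neg_one, h]
  exact inv_mul_cancel₀ Complex.two_pi_I_ne_zero

theorem ne_zero_of_norm_eq_one {z : ℂ} (hz : ‖z‖ = 1) : z ≠ 0 :=
  norm_ne_zero_iff.mp (by simp [hz])

theorem continuousAt_mul_zpow (c : ℂ) (n : ℤ) :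
    ∀ z : ℂ, ‖z‖ = 1 → ContinuousAt (fun z : ℂ => c * z ^ n) z := by
  intro z hz
  have hz0 := ne_zero_of_norm_eq_one hz
  exact continuousAt_const.mul (continuousAt_zpow₀ z n (Or.inl hz0))

theorem cint_four_zpow (a b c d : ℂ) (k l m n : ℤ) :
    cint (fun z => a * z ^ k + b * z ^ l + (c * z ^ m + d * z ^ n)) =
      a * cint (fun z => z ^ k) + b * cint (fun z => z ^ l) +
        (c * cint (fun z => z ^ m) + d * cint (fun z => z ^ n)) := by
  have h := continuousAt_mul_zpow
  rw [cint_add (fun z hz => (h a k z hz).fun_add (h b l z hz))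
    (fun z hz => (h c m z hz).fun_add (h d n z hz)), cint_add (h a k) (h b l),
    cint_add (h c m) (h d n)]
  simp only [cint_const_mul]

/-- The `n`-th power of the fundamental character, times the Weyl measure and the generating
function of the symmetric powers. -/
noncomputable def symMoment (t : ℂ) (n : ℕ) (z : ℂ) : ℂ :=
  (1 - z ^ 2) * ((z + 1 / z) ^ n * PE_B t [z, 1 / z]) / z

theorem one_sub_mul_ne_zero {t z : ℂ} (ht : ‖t‖ < 1) (hz : ‖z‖ ≤ 1) : 1 - t * z ≠ 0 := by
  intro h
  have h1 : ‖t * z‖ = 1 := by rw [← sub_eq_zero.mp h, norm_one]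
  rw [norm_mul] at h1
  nlinarith [norm_nonneg t, norm_nonneg z]

theorem PE_B_fundamental (t z : ℂ) : PE_B t [z, 1 / z] = ((1 - t * z) * (1 - t * (1 / z)))⁻¹ := by
  simp [PE_B]

theorem PE_B_denominators_ne_zero {t z : ℂ} (ht : ‖t‖ < 1) (hz : ‖z‖ = 1) :
    1 - t * z ≠ 0 ∧ 1 - t * (1 / z) ≠ 0 :=
  ⟨one_sub_mul_ne_zero ht hz.le, one_sub_mul_ne_zero ht (by simp [hz])⟩

theorem continuousAt_symMoment {t : ℂ} (ht : ‖t‖ < 1) (n : ℕ) :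
    ∀ z : ℂ, ‖z‖ = 1 → ContinuousAt (symMoment t n) z := by
  intro z hz
  have hz0 := ne_zero_of_norm_eq_one hz
  obtain ⟨h1, h2⟩ := PE_B_denominators_ne_zero ht hz
  unfold symMoment
  simp only [PE_B_fundamental]
  have h3 := mul_ne_zero h1 h2
  fun_prop (disch := assumption)

theorem cint_symMoment_zero {t : ℂ} (ht : ‖t‖ < 1) : cint (symMoment t 0) = 1 := by
  have hd : DifferentiableOn ℂ (fun z : ℂ => (1 - z ^ 2) / (1 - t * z)) (Metric.closedBall 0 1) := by
    intro z hz
    have h1 : 1 - t * z ≠ 0 := one_sub_mul_ne_zero ht (by simpa using hz)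
    exact DifferentiableAt.differentiableWithinAt (by fun_prop (disch := assumption))
  have h := hd.circleIntegral_sub_inv_smul (w := t) (by simpa using ht)
  have e : cint (symMoment t 0) =
      cint fun z => (z - t)⁻¹ • ((fun z : ℂ => (1 - z ^ 2) / (1 - t * z)) z) := by
    refine cint_congr fun z hz => ?_
    have hz0 := ne_zero_of_norm_eq_one hz
    obtain ⟨h1, h2⟩ := PE_B_denominators_ne_zero ht hz
    have h3 : z - t ≠ 0 := by
      intro h
      apply h2
      rw [← sub_eq_zero.mp h]
      field_simp
      ring
    have h4 : 1 - t * (1 / z) = (z - t) / z := by field_simp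
    simp only [symMoment, PE_B_fundamental, smul_eq_mul, h4]
    field_simp
  have ht2 : 1 - t ^ 2 ≠ 0 := by
    simpa [sq] using one_sub_mul_ne_zero ht ht.le
  rw [e, cint, h, smul_eq_mul, ← sq, div_self ht2, mul_one]
  exact inv_mul_cancel₀ Complex.two_pi_I_ne_zero

theorem symMoment_recurrence {t : ℂ} (ht : ‖t‖ < 1) (n : ℕ) :
    (1 + t ^ 2) * cint (symMoment t n) - t * cint (symMoment t (n + 1)) =
      cint fun z => (1 - z ^ 2) * (z + 1 / z) ^ n / z := by
  have hc : ∀ (a : ℂ) (n : ℕ) (z : ℂ), ‖z‖ = 1 → ContinuousAt (fun z => a * symMoment t n z) z :=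
    fun a n z hz => continuousAt_const.mul (continuousAt_symMoment ht n z hz)
  rw [sub_eq_add_neg, ← neg_mul, ← cint_const_mul, ← cint_const_mul, ← cint_add (hc _ _) (hc _ _)]
  refine cint_congr fun z hz => ?_
  have hz0 := ne_zero_of_norm_eq_one hz
  obtain ⟨h1, h2⟩ := PE_B_denominators_ne_zero ht hz
  have key : (1 + t ^ 2 - t * (z + 1 / z)) * ((1 - t * z) * (1 - t * (1 / z)))⁻¹ = 1 := by
    rw [show 1 + t ^ 2 - t * (z + 1 / z) = (1 - t * z) * (1 - t * (1 / z)) by field_simp; ring]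
    exact mul_inv_cancel₀ (mul_ne_zero h1 h2)
  simp only [symMoment, PE_B_fundamental]
  linear_combination ((1 - z ^ 2) * (z + 1 / z) ^ n / z) * key

theorem cint_weyl_character_pow :
    cint (fun z => (1 - z ^ 2) * (z + 1 / z) ^ 0 / z) = 1 ∧
    cint (fun z => (1 - z ^ 2) * (z + 1 / z) ^ 1 / z) = 0 ∧
    cint (fun z => (1 - z ^ 2) * (z + 1 / z) ^ 2 / z) = 1 ∧
    cint (fun z => (1 - z ^ 2) * (z + 1 / z) ^ 3 / z) = 0 := by
  have expand : ∀ (f : ℂ → ℂ) (a b c d : ℂ) (k l m n : ℤ),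
      (∀ z, ‖z‖ = 1 → f z = a * z ^ k + b * z ^ l + (c * z ^ m + d * z ^ n)) →
      cint f = a * cint (fun z => z ^ k) + b * cint (fun z => z ^ l) +
        (c * cint (fun z => z ^ m) + d * cint (fun z => z ^ n)) := fun f a b c d k l m n h =>
    (cint_congr h).trans (cint_four_zpow a b c d k l m n)
  refine ⟨?_, ?_, ?_, ?_⟩
  · rw [expand _ 1 (-1) 0 0 (-1) 1 1 1, cint_inv, cint_zpow (by norm_num)]
    · ring
    · intro z hz
      have hz0 := ne_zero_of_norm_eq_one hz
      simp only [zpow_neg, zpow_ofNat]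
      field_simp
      ring
  · rw [expand _ 1 (-1) 0 0 (-2) 2 2 2, cint_zpow (by norm_num), cint_zpow (by norm_num)]
    · ring
    · intro z hz
      have hz0 := ne_zero_of_norm_eq_one hz
      simp only [zpow_neg, zpow_ofNat]
      field_simp
      ring
  · rw [expand _ 1 1 (-1) (-1) (-1) (-3) 3 1, cint_inv, cint_zpow (by norm_num),
      cint_zpow (by norm_num), cint_zpow (by norm_num)]
    · ring
    · intro z hz
      have hz0 := ne_zero_of_norm_eq_one hz
      simp only [zpow_neg, zpow_ofNat]
      field_simp
      ring
  · rw [expand _ 1 2 (-2) (-1) (-4) (-2) 2 4, cint_zpow (by norm_num), cint_zpow (by norm_num),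
      cint_zpow (by norm_num), cint_zpow (by norm_num)]
    · ring
    · intro z hz
      have hz0 := ne_zero_of_norm_eq_one hz
      simp only [zpow_neg, zpow_ofNat]
      field_simp
      ring

theorem cint_symMoment {t : ℂ} (ht0 : t ≠ 0) (ht : ‖t‖ < 1) :
    cint (symMoment t 1) = t ∧ cint (symMoment t 2) = t ^ 2 + 1 ∧
    cint (symMoment t 3) = t ^ 3 + 2 * t ∧ cint (symMoment t 4) = t ^ 4 + 3 * t ^ 2 + 2 := by
  obtain ⟨c0, c1, c2, c3⟩ := cint_weyl_character_pow
  have m0 := cint_symMoment_zero ht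
  have r0 := symMoment_recurrence ht 0
  have r1 := symMoment_recurrence ht 1
  have r2 := symMoment_recurrence ht 2
  have r3 := symMoment_recurrence ht 3
  norm_num only [c0, c1, c2, c3, m0] at r0 r1 r2 r3
  have m1 : cint (symMoment t 1) = t := mul_left_cancel₀ ht0 (by linear_combination -r0)
  rw [m1] at r1
  have m2 : cint (symMoment t 2) = t ^ 2 + 1 := mul_left_cancel₀ ht0 (by linear_combination -r1)
  rw [m2] at r2
  have m3 : cint (symMoment t 3) = t ^ 3 + 2 * t :=
    mul_left_cancel₀ ht0 (by linear_combination -r2)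
  rw [m3] at r3
  exact ⟨m1, m2, m3, mul_left_cancel₀ ht0 (by linear_combination -r3)⟩

/-- The `SU(2)` average of a polynomial of degree at most four in the fundamental character, times
the generating function of the symmetric powers. -/
theorem nint_character_polynomial {t : ℂ} (ht0 : t ≠ 0) (ht : ‖t‖ < 1) {f : ℂ → ℂ}
    (a b c d e : ℂ)
    (hf : ∀ z, ‖z‖ = 1 → f z = (1 - z ^ 2) * ((a + b * (z + 1 / z) + c * (z + 1 / z) ^ 2 +
      d * (z + 1 / z) ^ 3 + e * (z + 1 / z) ^ 4) * PE_B t [z, 1 / z])) :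
    nint f = a + b * t + c * (t ^ 2 + 1) + d * (t ^ 3 + 2 * t) + e * (t ^ 4 + 3 * t ^ 2 + 2) := by
  obtain ⟨m1, m2, m3, m4⟩ := cint_symMoment ht0 ht
  have hc : ∀ (a : ℂ) (n : ℕ) (z : ℂ), ‖z‖ = 1 → ContinuousAt (fun z => a * symMoment t n z) z :=
    fun a n z hz => continuousAt_const.mul (continuousAt_symMoment ht n z hz)
  have hs : nint f = cint fun z => a * symMoment t 0 z + b * symMoment t 1 z +
      (c * symMoment t 2 z + (d * symMoment t 3 z + e * symMoment t 4 z)) := by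
    refine cint_congr fun z hz => ?_
    simp only [hf z hz, symMoment]
    ring
  rw [hs, cint_add (fun z hz => (hc a 0 z hz).fun_add (hc b 1 z hz))
    (fun z hz => (hc c 2 z hz).fun_add ((hc d 3 z hz).fun_add (hc e 4 z hz))),
    cint_add (hc a 0) (hc b 1),
    cint_add (hc c 2) (fun z hz => (hc d 3 z hz).fun_add (hc e 4 z hz)), cint_add (hc d 3) (hc e 4)]
  simp only [cint_const_mul, cint_symMoment_zero ht, m1, m2, m3, m4]
  ring

theorem PE_F_vector {u z w : ℂ} (hz : z ≠ 0) (hw : w ≠ 0) :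
    PE_F u [z * w, z / w, w / z, 1 / (z * w)] =
      1 + u ^ 4 - 2 * u ^ 2 + u ^ 2 * (z + 1 / z) ^ 2
        - u * (1 + u ^ 2) * (z + 1 / z) * (w + 1 / w) + u ^ 2 * (w + 1 / w) ^ 2 := by
  simp only [PE_F, List.map_cons, List.map_nil, List.prod_cons, List.prod_nil]
  field_simp
  ring

/-- Hilbert–Poincaré series counting Lorentz-invariant Spencer cochains linear
in the `D=4`, `N=1` super-Poincaré generators. -/
theorem statement_18 (t u : ℂ) (ht0 : 0 < ‖t‖) (ht : ‖t‖ < 1)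
    (hu0 : 0 < ‖u‖) (hu : ‖u‖ < 1) :
    (nint fun z => (1 - z ^ 2) *
      nint fun w => (1 - w ^ 2) *
        ((u⁻¹ * (z + 1 / z) * (w + 1 / w) - t⁻¹ * (z + 1 / z) - t⁻¹ * (w + 1 / w)
            + (z ^ 2 + 1 + 1 / z ^ 2) + (w ^ 2 + 1 + 1 / w ^ 2)) *
          PE_F u [z * w, z / w, w / z, 1 / (z * w)] *
          PE_B t [z, 1 / z] * PE_B t [w, 1 / w]))
      = -2 * t ^ 4 * u ^ 3 + 3 * t ^ 4 * u ^ 2 - t ^ 4 + 2 * t ^ 2 * u ^ 4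
        + t ^ 2 * u ^ 3 - 4 * t ^ 2 * u ^ 2 + 2 * t ^ 2 * u + t ^ 2 / u
        - 2 * u ^ 4 + 2 * u ^ 3 - u ^ 2 + 2 * u - 3 := by
  have ht0' : t ≠ 0 := norm_pos_iff.mp ht0
  have hu0' : u ≠ 0 := norm_pos_iff.mp hu0
  have inner : ∀ z : ℂ, ‖z‖ = 1 → _ := fun z hz =>
    nint_character_polynomial ht0' ht (f := fun w => (1 - w ^ 2) *
        ((u⁻¹ * (z + 1 / z) * (w + 1 / w) - t⁻¹ * (z + 1 / z) - t⁻¹ * (w + 1 / w)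
            + (z ^ 2 + 1 + 1 / z ^ 2) + (w ^ 2 + 1 + 1 / w ^ 2)) *
          PE_F u [z * w, z / w, w / z, 1 / (z * w)] *
          PE_B t [z, 1 / z] * PE_B t [w, 1 / w]))
      (((z + 1 / z) ^ 2 - t⁻¹ * (z + 1 / z) - 2) *
        (1 + u ^ 4 - 2 * u ^ 2 + u ^ 2 * (z + 1 / z) ^ 2) * PE_B t [z, 1 / z])
      ((((z + 1 / z) ^ 2 - t⁻¹ * (z + 1 / z) - 2) * (-u * (1 + u ^ 2) * (z + 1 / z)) +
        (u⁻¹ * (z + 1 / z) - t⁻¹) * (1 + u ^ 4 - 2 * u ^ 2 + u ^ 2 * (z + 1 / z) ^ 2)) *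
          PE_B t [z, 1 / z])
      ((((z + 1 / z) ^ 2 - t⁻¹ * (z + 1 / z) - 2) * u ^ 2 +
        (u⁻¹ * (z + 1 / z) - t⁻¹) * (-u * (1 + u ^ 2) * (z + 1 / z)) +
        (1 + u ^ 4 - 2 * u ^ 2 + u ^ 2 * (z + 1 / z) ^ 2)) * PE_B t [z, 1 / z])
      (((u⁻¹ * (z + 1 / z) - t⁻¹) * u ^ 2 - u * (1 + u ^ 2) * (z + 1 / z)) * PE_B t [z, 1 / z])
      (u ^ 2 * PE_B t [z, 1 / z]) (fun w hw => by
        have hz0 := ne_zero_of_norm_eq_one hz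
        have hw0 := ne_zero_of_norm_eq_one hw
        have sz : z ^ 2 + 1 + 1 / z ^ 2 = (z + 1 / z) ^ 2 - 1 := by field_simp; ring
        have sw : w ^ 2 + 1 + 1 / w ^ 2 = (w + 1 / w) ^ 2 - 1 := by field_simp; ring
        rw [PE_F_vector hz0 hw0, sz, sw]
        ring)
  rw [nint_character_polynomial ht0' ht
      (-2 + 2 * u ^ 2 - 2 * u ^ 4 + t ^ 2 - 2 * t ^ 2 * u ^ 2 + t ^ 2 * u ^ 4 + t ^ 4 * u ^ 2)
      (t⁻¹ * (-1 + u + u ^ 2 + u ^ 3 - u ^ 4) + t * (u⁻¹ + u - u ^ 2 + 2 * u ^ 3) - t ^ 3 * u ^ 3)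
      (u - 4 * u ^ 2 + u ^ 3 + u ^ 4 - t ^ 2 + t ^ 2 * u ^ 2)
      (-t⁻¹ * u ^ 2 - t * u ^ 3)
      (u ^ 2)]
  · field_simp
    ring
  · intro z hz
    rw [inner z hz]
    generalize PE_B t [z, 1 / z] = p
    generalize z + 1 / z = x
    field_simp
    ring
end
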